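/- The product space Σℕ × Σ2 of the Scott space of ℕ (usual order) and the Sierpiński space Σ2 is not a d*-space, although both factors are d*-spaces. In particular, the product of two d*-spaces need not be a d*-space. -/

import Mathlib

open Set
/-- The specialization order on a topological space: `x ≤ y` iff `x ∈ closure {y}`. -/
def specLE {X : Type*} [TopologicalSpace X] (x y : X) : Prop := x ∈ closure {y}

/-- The upper closure `↑x = {y | x ≤ y}` of a point in the specialization order. -/
def upSet {X : Type*} [TopologicalSpace X] (x : X) : Set X := {y | specLE x y}

/-- A `T₀` space `X` is a *d\*-space* if for every (nonempty) directed subset `D` of `X`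
(in the specialization order), every `x ∈ X` and every nonempty open `U`,
`⋂_{d ∈ D} ↑d ∩ ↑x ⊆ U` implies `↑d ∩ ↑x ⊆ U` for some `d ∈ D`. -/
def IsDStarSpace (X : Type*) [TopologicalSpace X] : Prop :=
  ∀ D : Set X, D.Nonempty → DirectedOn specLE D → ∀ x : X, ∀ U : Set X,
    IsOpen U → U.Nonempty →
    (⋂ d ∈ D, upSet d) ∩ upSet x ⊆ U → ∃ d ∈ D, upSet d ∩ upSet x ⊆ U
/-- The Scott topology on a preorder: opens are the upper sets `U` such that every
directed set having a least upper bound in `U` meets `U`. -/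
def scottTopology (P : Type*) [Preorder P] : TopologicalSpace P where
  IsOpen U := IsUpperSet U ∧
    ∀ D : Set P, D.Nonempty → DirectedOn (· ≤ ·) D → ∀ a : P, IsLUB D a → a ∈ U →
      (D ∩ U).Nonempty
  isOpen_univ :=
    ⟨isUpperSet_univ, fun _ hD _ _ _ _ => hD.imp fun _ hd => ⟨hd, trivial⟩⟩
  isOpen_inter U V hU hV := by
    refine ⟨hU.1.inter hV.1, fun D hD hdir a ha haUV => ?_⟩
    obtain ⟨d₁, hd₁D, hd₁U⟩ := hU.2 D hD hdir a ha haUV.1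
    obtain ⟨d₂, hd₂D, hd₂V⟩ := hV.2 D hD hdir a ha haUV.2
    obtain ⟨d₃, hd₃D, h₁₃, h₂₃⟩ := hdir d₁ hd₁D d₂ hd₂D
    exact ⟨d₃, hd₃D, hU.1 h₁₃ hd₁U, hV.1 h₂₃ hd₂V⟩
  isOpen_sUnion S hS := by
    refine ⟨isUpperSet_sUnion fun U hU => (hS U hU).1, fun D hD hdir a ha haS => ?_⟩
    obtain ⟨U, hUS, haU⟩ := haS
    obtain ⟨d, hdD, hdU⟩ := (hS U hUS).2 D hD hdir a ha haU
    exact ⟨d, hdD, U, hUS, hdU⟩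

theorem isOpen_scottTopology_compl_Iic {P : Type*} [Preorder P] (a : P) :
    @IsOpen P (scottTopology P) (Iic a)ᶜ := by
  refine ⟨(isLowerSet_Iic a).compl, fun D _ _ b hb hba => ?_⟩
  by_contra h
  exact hba (hb.2 fun d hd => by_contra fun hda => h ⟨d, hd, hda⟩)

theorem specLE_iff_specializes {X : Type*} [TopologicalSpace X] {x y : X} :
    specLE x y ↔ y ⤳ x :=
  specializes_iff_mem_closure.symm

/-- The specialization order of the Scott topology is the original order. -/
theorem specLE_scottTopology_iff {P : Type*} [Preorder P] {x y : P} :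
    @specLE P (scottTopology P) x y ↔ x ≤ y := by
  let _ : TopologicalSpace P := scottTopology P
  rw [specLE_iff_specializes, specializes_iff_forall_open]
  constructor
  · intro h
    by_contra hxy
    exact h _ (isOpen_scottTopology_compl_Iic y) hxy le_rfl
  · intro h U hU hx
    exact hU.1 h hx

/-- A chain whose bounded subsets are finite is a d*-space in its Scott topology. -/
theorem isDStarSpace_scottTopology_of_finite {P : Type*} [LinearOrder P]
    (hfin : ∀ D : Set P, BddAbove D → D.Finite) :
    @IsDStarSpace P (scottTopology P) := by
  let _ : TopologicalSpace P := scottTopology P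
  intro D hD _ x U hU ⟨u, hu⟩ hsub
  by_cases hb : BddAbove D
  · obtain ⟨m, hm, hmax⟩ := exists_max_image D id (hfin D hb) hD
    refine ⟨m, hm, fun y ⟨hmy, hxy⟩ => hsub ⟨mem_iInter₂.2 fun d hd => ?_, hxy⟩⟩
    exact specLE_scottTopology_iff.2 ((hmax d hd).trans (specLE_scottTopology_iff.1 hmy))
  · obtain ⟨d, hd, hud⟩ := not_bddAbove_iff.1 hb u
    exact ⟨d, hd, fun y hy => hU.1 (hud.le.trans (specLE_scottTopology_iff.1 hy.1)) hu⟩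

/-- The specialization order of a product of Scott spaces is the product order. -/
theorem specLE_prod_scottTopology_iff {P Q : Type*} [Preorder P] [Preorder Q] {x y : P × Q} :
    @specLE (P × Q) (@instTopologicalSpaceProd P Q (scottTopology P) (scottTopology Q)) x y ↔
      x ≤ y := by
  let _ : TopologicalSpace P := scottTopology P
  let _ : TopologicalSpace Q := scottTopology Q
  rw [specLE_iff_specializes, specializes_prod, ← specLE_iff_specializes,
    ← specLE_iff_specializes, specLE_scottTopology_iff, specLE_scottTopology_iff, Prod.le_def]

/-- `Σℕ` (the Scott space of `ℕ` with the usual order) and the Sierpiński space `Σ2`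
(the Scott space of the two-element chain, formalized as `Bool` with `false < true`) are
both d*-spaces, but their product `Σℕ × Σ2` is not a d*-space.  In particular, the product
of two d*-spaces need not be a d*-space. -/
theorem prod_scottNat_sierpinski_not_dstar :
    @IsDStarSpace ℕ (scottTopology ℕ) ∧ @IsDStarSpace Bool (scottTopology Bool) ∧
    ¬ @IsDStarSpace (ℕ × Bool)
        (@instTopologicalSpaceProd ℕ Bool (scottTopology ℕ) (scottTopology Bool)) := by
  refine ⟨isDStarSpace_scottTopology_of_finite fun D hD => hD.finite,
    isDStarSpace_scottTopology_of_finite fun D _ => D.toFinite, fun h => ?_⟩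
  let _ : TopologicalSpace ℕ := scottTopology ℕ
  let _ : TopologicalSpace Bool := scottTopology Bool
  have hdir : DirectedOn specLE (range fun n : ℕ => (n, false)) := by
    rintro _ ⟨m, rfl⟩ _ ⟨n, rfl⟩
    exact ⟨_, ⟨max m n, rfl⟩, specLE_prod_scottTopology_iff.2 ⟨le_max_left m n, le_rfl⟩,
      specLE_prod_scottTopology_iff.2 ⟨le_max_right m n, le_rfl⟩⟩
  have hsub : (⋂ d ∈ range fun n : ℕ => (n, false), upSet d) ∩ upSet (0, false) ⊆
      Prod.snd ⁻¹' (Iic false)ᶜ := by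
    rintro ⟨k, b⟩ ⟨hk, -⟩
    have hle := specLE_prod_scottTopology_iff.1 (mem_iInter₂.1 hk _ ⟨k + 1, rfl⟩)
    exact absurd hle.1 (Nat.not_succ_le_self k)
  obtain ⟨_, ⟨n, rfl⟩, hn⟩ := h _ (range_nonempty _) hdir (0, false) _
    ((isOpen_scottTopology_compl_Iic false).preimage continuous_snd) ⟨(0, true), by simp⟩ hsub
  have hmem : (n, false) ∈ Prod.snd ⁻¹' (Iic false)ᶜ :=
    hn ⟨specLE_prod_scottTopology_iff.2 le_rfl,
      specLE_prod_scottTopology_iff.2 ⟨Nat.zero_le n, le_rfl⟩⟩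
  exact hmem (mem_Iic.2 le_rfl)
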